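/- Let α > 0, let n be an integer with |n| ≥ 1, let R > 0 and let κ > −(r₀² + n²)/(2R²). Then there exists a constant C₁ > 0 such that every u in the Nehari set M satisfies ∫₀^R ( r u'(r)² + u(r)²/r ) dr ≥ C₁. -/

import Mathlib

open MeasureTheory Set Filter

noncomputable section

/-- The Bessel function `J₀`. -/
def besselJ0 (x : ℝ) : ℝ :=
  ∑' m : ℕ, (-1 : ℝ) ^ m * (x / 2) ^ (2 * m) / ((Nat.factorial m : ℝ)) ^ 2

/-- The smallest positive zero of `J₀` (≈ 2.404826). -/
def besselR0 : ℝ := sInf {x : ℝ | 0 < x ∧ besselJ0 x = 0}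

/-- `u` is a classical solution of the `n`-vortex equation with parameters `(α, n, κ, R)`. -/
def IsVortexSol (α : ℝ) (n : ℤ) (κ R : ℝ) (u : ℝ → ℝ) : Prop :=
  ContinuousOn u (Icc 0 R) ∧
  (∀ r ∈ Ioo (0 : ℝ) R, DifferentiableAt ℝ u r ∧ DifferentiableAt ℝ (deriv u) r) ∧
  u 0 = 0 ∧ u R = 0 ∧
  ∀ r ∈ Ioo (0 : ℝ) R,
    deriv (fun s => s * deriv u s) r - ((n : ℝ) ^ 2 / r) * u r
      + 2 * r * (u r) ^ 3 / (1 + α * (u r) ^ 2) - 2 * κ * r * u r = 0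

/-- `u` has finite energy. -/
def FiniteEnergy (α R : ℝ) (u : ℝ → ℝ) : Prop :=
  IntegrableOn
    (fun r => r * (deriv u r) ^ 2 + (u r) ^ 2 / r + r * Real.log (1 + α * (u r) ^ 2))
    (Ioo 0 R)

/-- The energy flux `Q(u) = 2π ∫₀^R r u(r)² dr`. -/
def fluxQ (R : ℝ) (u : ℝ → ℝ) : ℝ := 2 * Real.pi * ∫ r in Ioo (0 : ℝ) R, r * (u r) ^ 2

/-- The tent function with parameters `a` and `b`. -/
def tent (a b : ℝ) : ℝ → ℝ := fun r => if r ≤ a then (b / a) * r else (b / a) * (2 * a - r)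

/-- The action functional `I_κ`. -/
def actI (α : ℝ) (n : ℤ) (κ R : ℝ) (u : ℝ → ℝ) : ℝ :=
  (1 / 2) * ∫ r in Ioo (0 : ℝ) R,
    (r * (deriv u r) ^ 2 + ((n : ℝ) ^ 2 / r) * (u r) ^ 2
      - 2 * (α⁻¹ - κ) * r * (u r) ^ 2 + 2 * (α ^ 2)⁻¹ * r * Real.log (1 + α * (u r) ^ 2))

/-- The action functional `𝓘`. -/
def actI0 (α : ℝ) (n : ℤ) (R : ℝ) (u : ℝ → ℝ) : ℝ :=
  (1 / 2) * ∫ r in Ioo (0 : ℝ) R,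
    (r * (deriv u r) ^ 2 + ((n : ℝ) ^ 2 / r) * (u r) ^ 2
      - 2 * α⁻¹ * r * (u r) ^ 2 + 2 * (α ^ 2)⁻¹ * r * Real.log (1 + α * (u r) ^ 2))

/-- The functional `γ_κ`. -/
def gammaK (α : ℝ) (n : ℤ) (κ R : ℝ) (u : ℝ → ℝ) : ℝ :=
  (1 / 2) * ∫ r in Ioo (0 : ℝ) R,
    (r * (deriv u r) ^ 2 + ((n : ℝ) ^ 2 / r) * (u r) ^ 2
      - 2 * (α⁻¹ - κ) * r * (u r) ^ 2 + 2 * α⁻¹ * r * (u r) ^ 2 / (1 + α * (u r) ^ 2))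

/-- Membership in the class `X`. -/
def MemX (R : ℝ) (u : ℝ → ℝ) : Prop :=
  ContinuousOn u (Icc 0 R) ∧ ContDiffOn ℝ 1 u (Ioo 0 R) ∧ u 0 = 0 ∧ u R = 0 ∧
    IntegrableOn (fun r => r * (deriv u r) ^ 2 + (u r) ^ 2 / r) (Ioo 0 R)

/-- Membership in the class `X`, allowing finitely many exceptional points. -/
def MemX' (R : ℝ) (u : ℝ → ℝ) : Prop :=
  ContinuousOn u (Icc 0 R) ∧ (∃ S : Finset ℝ, ContDiffOn ℝ 1 u (Ioo 0 R \ ↑S)) ∧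
    u 0 = 0 ∧ u R = 0 ∧
    IntegrableOn (fun r => r * (deriv u r) ^ 2 + (u r) ^ 2 / r) (Ioo 0 R)

/-- The admissible class `𝒜`. -/
def Admissible (α R : ℝ) (v : ℝ → ℝ) : Prop :=
  (∃ K : NNReal, LipschitzOnWith K v (Icc 0 R)) ∧ v 0 = 0 ∧ v R = 0 ∧ FiniteEnergy α R v

end

section aux

lemma aux_hasDerivAt (a : ℕ → ℝ) (ha : ∀ m, |a m| ≤ 1 / (Nat.factorial m : ℝ)) (x : ℝ) :
    HasDerivAt (fun t => ∑' m, a m * t ^ m) (∑' m, a m * (m * x ^ (m - 1))) x := by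
  have hs : Summable (fun m : ℕ => |a m| * (m * (|x| + 1) ^ (m - 1))) := by
    rw [← summable_nat_add_iff 1]
    refine Summable.of_nonneg_of_le (fun m => by positivity) (fun m => ?_)
      (Real.summable_pow_div_factorial (|x| + 1))
    have h := ha (m + 1)
    have : (0 : ℝ) < (m.factorial : ℝ) := by positivity
    calc |a (m + 1)| * (((m + 1 : ℕ) : ℝ) * (|x| + 1) ^ (m + 1 - 1))
        ≤ 1 / ((m + 1).factorial : ℝ) * (((m + 1 : ℕ) : ℝ) * (|x| + 1) ^ (m + 1 - 1)) := by
          gcongr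
      _ = (|x| + 1) ^ m / (m.factorial : ℝ) := by
          rw [Nat.factorial_succ]
          push_cast
          try simp only [Nat.add_sub_cancel]
          have : (m : ℝ) + 1 ≠ 0 := by positivity
          field_simp
  refine hasDerivAt_tsum_of_isPreconnected (g := fun m t => a m * t ^ m)
    (g' := fun m t => a m * (m * t ^ (m - 1))) (y := x) (t := Metric.ball 0 (|x| + 1)) (y₀ := 0)
    hs Metric.isOpen_ball
    (convex_ball (0 : ℝ) (|x| + 1)).isPreconnected (fun m y _ => ?_) (fun m y hy => ?_) ?_ ?_ ?_
  · exact (hasDerivAt_pow m y).const_mul (a m)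
  · simp only [Metric.mem_ball, dist_zero_right, Real.norm_eq_abs] at hy
    rw [norm_mul, norm_mul, norm_pow, Real.norm_eq_abs, Real.norm_eq_abs, Real.norm_eq_abs,
      Nat.abs_cast]
    gcongr
  · simp only [Metric.mem_ball, dist_self]; positivity
  · refine summable_of_ne_finset_zero (s := {0}) (fun m hm => ?_)
    simp at hm
    simp [hm]
  · simp

/-- `g(t) = J₀(2 √t)`. -/
noncomputable def gB (t : ℝ) : ℝ := ∑' m : ℕ, ((-1 : ℝ) ^ m / (Nat.factorial m : ℝ) ^ 2) * t ^ m

noncomputable def hB (t : ℝ) : ℝ := ∑' m : ℕ, ((-1 : ℝ) ^ m * m / (Nat.factorial m : ℝ) ^ 2) * t ^ m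

noncomputable def kB (t : ℝ) : ℝ :=
  ∑' m : ℕ, ((-1 : ℝ) ^ m / (Nat.factorial m : ℝ) ^ 2) * (m * t ^ (m - 1))

lemma hasDerivAt_gB (t : ℝ) : HasDerivAt gB (kB t) t := by
  refine aux_hasDerivAt (fun m => (-1 : ℝ) ^ m / (Nat.factorial m : ℝ) ^ 2) (fun m => ?_) t
  rw [abs_div, abs_pow, abs_neg, abs_one, one_pow, abs_of_pos (by positivity)]
  have h1 : (1 : ℝ) ≤ m.factorial := by exact_mod_cast Nat.one_le_iff_ne_zero.2 m.factorial_ne_zero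
  exact one_div_le_one_div_of_le (by positivity) (by nlinarith)

lemma hB_eq (t : ℝ) : hB t = t * kB t := by
  rw [hB, kB, ← tsum_mul_left]
  congr 1
  ext m
  rcases m with _ | m
  · simp
  · simp only [Nat.add_sub_cancel]; ring

lemma hasDerivAt_hB (t : ℝ) : HasDerivAt hB (- gB t) t := by
  have key := aux_hasDerivAt (fun m => (-1 : ℝ) ^ m * m / (Nat.factorial m : ℝ) ^ 2)
    (fun m => ?_) t
  · have hsum : Summable (fun m : ℕ => ((-1 : ℝ) ^ m / (Nat.factorial m : ℝ) ^ 2) * t ^ m) := by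
      refine Summable.of_norm_bounded (Real.summable_pow_div_factorial |t|) (fun m => ?_)
      rw [norm_mul, norm_div, norm_pow, norm_neg, norm_one, one_pow, norm_pow, norm_pow,
        Real.norm_eq_abs, Real.norm_eq_abs, Nat.abs_cast]
      have h1 : (1 : ℝ) ≤ m.factorial := by
        exact_mod_cast Nat.one_le_iff_ne_zero.2 m.factorial_ne_zero
      rw [div_mul_eq_mul_div, one_mul]
      exact div_le_div_of_nonneg_left (by positivity) (by positivity) (by nlinarith)
    have hterm : ∀ m : ℕ, (-1 : ℝ) ^ (m + 1) * ((m + 1 : ℕ) : ℝ) / ((m + 1).factorial : ℝ) ^ 2 *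
        (((m + 1 : ℕ) : ℝ) * t ^ (m + 1 - 1))
        = -(((-1 : ℝ) ^ m / (Nat.factorial m : ℝ) ^ 2) * t ^ m) := by
      intro m
      rw [Nat.factorial_succ]
      push_cast
      try simp only [Nat.add_sub_cancel]
      have : (m : ℝ) + 1 ≠ 0 := by positivity
      have : (m.factorial : ℝ) ≠ 0 := by positivity
      field_simp
      ring
    have hs2 : Summable (fun m : ℕ => (-1 : ℝ) ^ m * m / (Nat.factorial m : ℝ) ^ 2 *
        (m * t ^ (m - 1))) := by
      rw [← summable_nat_add_iff 1]
      exact hsum.neg.congr (fun m => (hterm m).symm)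
    have hval : ∑' m : ℕ, (-1 : ℝ) ^ m * m / (Nat.factorial m : ℝ) ^ 2 * (m * t ^ (m - 1))
        = - gB t := by
      rw [hs2.tsum_eq_zero_add]
      simp only [hterm]
      rw [tsum_neg]
      simp [gB]
    rw [hval] at key
    exact key
  · rw [abs_div, abs_mul, abs_pow, abs_neg, abs_one, one_pow, one_mul, Nat.abs_cast,
      abs_of_pos (by positivity : (0 : ℝ) < (m.factorial : ℝ) ^ 2)]
    have h1 : (0 : ℝ) < m.factorial := by positivity
    have h2 : (m : ℝ) ≤ m.factorial := by exact_mod_cast m.self_le_factorial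
    rw [div_le_div_iff₀ (by positivity) h1]
    nlinarith

lemma besselJ0_eq (x : ℝ) : besselJ0 x = gB (x ^ 2 / 4) := by
  unfold besselJ0 gB
  congr 1
  ext m
  rw [pow_mul, show (x / 2) ^ 2 = x ^ 2 / 4 by ring]
  ring

lemma besselJ0_pos (x : ℝ) (h0 : 0 ≤ x) (hx : x < besselR0) : 0 < besselJ0 x := by
  by_contra hneg
  push Not at hneg
  have hc : Continuous besselJ0 := by
    have : besselJ0 = fun x => gB (x ^ 2 / 4) := funext besselJ0_eq
    rw [this]
    have hg : Continuous gB := continuous_iff_continuousAt.2 fun t => (hasDerivAt_gB t).continuousAt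
    exact hg.comp (by fun_prop)
  have hz : besselJ0 0 = 1 := by
    unfold besselJ0
    rw [tsum_eq_single 0]
    · simp
    · intro m hm; simp [hm]
  obtain ⟨y, hy, hy0⟩ := intermediate_value_Icc' h0 hc.continuousOn
    (show (0 : ℝ) ∈ Icc (besselJ0 x) (besselJ0 0) from ⟨hneg, by rw [hz]; norm_num⟩)
  have hypos : 0 < y := by
    rcases hy.1.eq_or_lt with h | h
    · rw [← h, hz] at hy0; norm_num at hy0
    · exact h
  have : besselR0 ≤ y := csInf_le ⟨0, fun z hz => hz.1.le⟩ ⟨hypos, hy0⟩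
  linarith [hy.2]

lemma besselR0_nonneg : 0 ≤ besselR0 := Real.sInf_nonneg fun _ hz => hz.1.le

structure XFacts (R : ℝ) (u : ℝ → ℝ) : Prop where
  iA : IntegrableOn (fun r => r * (deriv u r) ^ 2) (Ioo 0 R)
  iB : IntegrableOn (fun r => (u r) ^ 2 / r) (Ioo 0 R)
  iD : IntegrableOn (fun r => r * (u r) ^ 2) (Ioo 0 R)
  diff : ∀ r ∈ Ioo (0 : ℝ) R, HasDerivAt u (deriv u r) r

lemma xfacts (R : ℝ) (u : ℝ → ℝ) (h : MemX R u) : XFacts R u := by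
  obtain ⟨hc, hd, h0, hR, hi⟩ := h
  have hdc : ContinuousOn (deriv u) (Ioo 0 R) :=
    hd.continuousOn_deriv_of_isOpen isOpen_Ioo le_rfl
  have huc : ContinuousOn u (Ioo 0 R) := hc.mono Ioo_subset_Icc_self
  have iB : IntegrableOn (fun r => (u r) ^ 2 / r) (Ioo 0 R) := by
    refine Integrable.mono' hi ?_ ?_
    · refine ContinuousOn.aestronglyMeasurable ?_ measurableSet_Ioo
      exact (huc.pow 2).div continuousOn_id (fun x hx => hx.1.ne')
    · refine (ae_restrict_iff' measurableSet_Ioo).2 (ae_of_all _ fun r hr => ?_)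
      have := hr.1
      rw [Real.norm_of_nonneg (by positivity)]
      have : 0 ≤ r * deriv u r ^ 2 := by positivity
      linarith
  refine ⟨?_, iB, ?_, ?_⟩
  · refine Integrable.mono' hi ?_ ?_
    · refine ContinuousOn.aestronglyMeasurable ?_ measurableSet_Ioo
      exact continuousOn_id.mul (hdc.pow 2)
    · refine (ae_restrict_iff' measurableSet_Ioo).2 (ae_of_all _ fun r hr => ?_)
      have := hr.1
      rw [Real.norm_of_nonneg (by positivity)]
      have : 0 ≤ u r ^ 2 / r := by positivity
      linarith
  · have : ContinuousOn (fun r => r * (u r) ^ 2) (Icc 0 R) := continuousOn_id.mul (hc.pow 2)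
    exact this.integrableOn_Icc.mono_set Ioo_subset_Icc_self
  · intro r hr
    exact ((hd.differentiableOn one_ne_zero).differentiableAt (isOpen_Ioo.mem_nhds hr)).hasDerivAt

lemma sup_bound (R : ℝ) (u : ℝ → ℝ) (h : MemX R u) (x : ℝ) (hx : x ∈ Icc 0 R) :
    u x ^ 2 ≤ ∫ r in Ioo (0 : ℝ) R, (r * (deriv u r) ^ 2 + (u r) ^ 2 / r) := by
  have hf := xfacts R u h
  obtain ⟨hc, hd, h0, hR, hi⟩ := h
  have key := intervalIntegral.sub_le_integral_of_hasDeriv_right_of_le (a := 0) (b := x)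
    (g := fun r => u r ^ 2) (g' := fun r => 2 * u r * deriv u r)
    (φ := fun r => r * (deriv u r) ^ 2 + (u r) ^ 2 / r) hx.1
    ((hc.mono (Icc_subset_Icc_right hx.2)).pow 2)
    (fun r hr => ?_) ?_ (fun r hr => ?_)
  · rw [h0] at key
    rw [intervalIntegral.integral_of_le hx.1, ← integral_Ioc_eq_integral_Ioo.symm] at key
    have := setIntegral_mono_set (s := Ioo 0 x) hi
      ((ae_restrict_iff' measurableSet_Ioo).2 (ae_of_all _ fun r hr => by
        have := hr.1
        show 0 ≤ r * deriv u r ^ 2 + u r ^ 2 / r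
        positivity))
      (Ioo_subset_Ioo_right hx.2).eventuallyLE
    simp at key
    linarith
  · have := (hf.diff r ⟨hr.1, hr.2.trans_le hx.2⟩).pow 2
    exact (this.congr_deriv (by simp)).hasDerivWithinAt
  · rw [integrableOn_Icc_iff_integrableOn_Ioo]
    exact hi.mono_set (Ioo_subset_Ioo_right hx.2)
  · have := hr.1
    have e : r * deriv u r ^ 2 + u r ^ 2 / r - 2 * u r * deriv u r
      = (r * deriv u r - u r) ^ 2 / r := by field_simp; ring
    have : 0 ≤ (r * deriv u r - u r) ^ 2 / r := by positivity
    linarith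

lemma poincare_lt (R : ℝ) (hR : 0 < R) (u : ℝ → ℝ) (h : MemX R u) (l : ℝ) (hl0 : 0 ≤ l)
    (hl : l * R < besselR0) :
    l ^ 2 * ∫ r in Ioo (0 : ℝ) R, r * (u r) ^ 2 ≤ ∫ r in Ioo (0 : ℝ) R, r * (deriv u r) ^ 2 := by
  have hf := xfacts R u h
  obtain ⟨hc, hd, h0, huR, hi⟩ := h
  have hpos : ∀ r ∈ Icc 0 R, 0 < gB (l ^ 2 * r ^ 2 / 4) := by
    intro r hr
    have := besselJ0_pos (l * r) (mul_nonneg hl0 hr.1)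
      ((mul_le_mul_of_nonneg_left hr.2 hl0).trans_lt hl)
    rwa [besselJ0_eq, mul_pow] at this
  have hs : ∀ r : ℝ, HasDerivAt (fun r => l ^ 2 * r ^ 2 / 4) (l ^ 2 * r / 2) r := by
    intro r
    have := ((hasDerivAt_pow 2 r).const_mul (l ^ 2)).div_const 4
    exact this.congr_deriv (by norm_num; ring)
  have hg : ∀ r : ℝ, HasDerivAt (fun r => gB (l ^ 2 * r ^ 2 / 4))
      (kB (l ^ 2 * r ^ 2 / 4) * (l ^ 2 * r / 2)) r :=
    fun r => (hasDerivAt_gB _).comp r (hs r)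
  have hh : ∀ r : ℝ, HasDerivAt (fun r => hB (l ^ 2 * r ^ 2 / 4))
      (- gB (l ^ 2 * r ^ 2 / 4) * (l ^ 2 * r / 2)) r :=
    fun r => (hasDerivAt_hB _).comp r (hs r)
  have hgc : Continuous (fun r => gB (l ^ 2 * r ^ 2 / 4)) :=
    continuous_iff_continuousAt.2 fun t => (hg t).continuousAt
  have hhc : Continuous (fun r => hB (l ^ 2 * r ^ 2 / 4)) :=
    continuous_iff_continuousAt.2 fun t => (hh t).continuousAt
  have hint : IntegrableOn (fun r => r * (deriv u r) ^ 2 - l ^ 2 * (r * (u r) ^ 2)) (Ioo 0 R) :=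
    hf.iA.sub (hf.iD.const_mul _)
  have key := intervalIntegral.sub_le_integral_of_hasDeriv_right_of_le (a := 0) (b := R)
    (g := fun r => 2 * hB (l ^ 2 * r ^ 2 / 4) * u r ^ 2 / gB (l ^ 2 * r ^ 2 / 4))
    (g' := fun r => ((2 * (- gB (l ^ 2 * r ^ 2 / 4) * (l ^ 2 * r / 2)) * u r ^ 2 +
        2 * hB (l ^ 2 * r ^ 2 / 4) * (2 * u r * deriv u r)) * gB (l ^ 2 * r ^ 2 / 4)
        - 2 * hB (l ^ 2 * r ^ 2 / 4) * u r ^ 2 * (kB (l ^ 2 * r ^ 2 / 4) * (l ^ 2 * r / 2)))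
        / gB (l ^ 2 * r ^ 2 / 4) ^ 2)
    (φ := fun r => r * (deriv u r) ^ 2 - l ^ 2 * (r * (u r) ^ 2)) hR.le
    ?_ (fun r hr => ?_) ?_ (fun r hr => ?_)
  · rw [h0, huR, intervalIntegral.integral_of_le hR.le, integral_Ioc_eq_integral_Ioo,
      integral_sub hf.iA (hf.iD.const_mul _), integral_const_mul] at key
    simp at key
    linarith
  · exact ((continuousOn_const.mul hhc.continuousOn).mul (hc.pow 2)).div hgc.continuousOn
      (fun r hr => (hpos r hr).ne')
  · have hu2 : HasDerivAt (fun r => u r ^ 2) (2 * u r * deriv u r) r := by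
      exact ((hf.diff r hr).pow 2).congr_deriv (by simp)
    exact ((((hh r).const_mul 2).mul hu2).div (hg r)
      (hpos r (Ioo_subset_Icc_self hr)).ne').hasDerivWithinAt
  · rw [integrableOn_Icc_iff_integrableOn_Ioo]
    exact hint
  · have hp := hpos r (Ioo_subset_Icc_self hr)
    rw [hB_eq]
    have hr0 := hr.1
    set G := gB (l ^ 2 * r ^ 2 / 4)
    set K := kB (l ^ 2 * r ^ 2 / 4)
    rw [div_le_iff₀ (by positivity)]
    have : 0 ≤ r * (deriv u r * G - K * (l ^ 2 * r / 2) * u r) ^ 2 := by positivity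
    nlinarith

lemma poincare (R : ℝ) (hR : 0 < R) (u : ℝ → ℝ) (h : MemX R u) :
    besselR0 ^ 2 * ∫ r in Ioo (0 : ℝ) R, r * (u r) ^ 2 ≤
      R ^ 2 * ∫ r in Ioo (0 : ℝ) R, r * (deriv u r) ^ 2 := by
  set D := ∫ r in Ioo (0 : ℝ) R, r * (u r) ^ 2
  set A := ∫ r in Ioo (0 : ℝ) R, r * (deriv u r) ^ 2 with hA
  have hA0 : 0 ≤ A := setIntegral_nonneg measurableSet_Ioo fun r hr => by
    have := hr.1; positivity
  rcases besselR0_nonneg.eq_or_lt with h0 | h0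
  · rw [← h0]; simp; positivity
  have hev : ∀ᶠ x in nhdsWithin besselR0 (Iio besselR0), x ^ 2 * D ≤ R ^ 2 * A := by
    filter_upwards [Ioo_mem_nhdsLT h0] with x hx
    have := poincare_lt R hR u h (x / R) (div_nonneg hx.1.le hR.le)
      (by rw [div_mul_cancel₀ _ hR.ne']; exact hx.2)
    rw [div_pow, div_mul_eq_mul_div, div_le_iff₀ (by positivity)] at this
    linarith
  have hc : Continuous fun x : ℝ => x ^ 2 * D := by fun_prop
  exact le_of_tendsto (hc.continuousAt.tendsto.mono_left nhdsWithin_le_nhds) hev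

end aux

/-- uniform lower bound for the `H`-norm on the Nehari set. -/
theorem stmt13 (α : ℝ) (hα : 0 < α) (n : ℤ) (hn : 1 ≤ |n|) (R : ℝ) (hR : 0 < R)
    (κ : ℝ) (hκ : -(besselR0 ^ 2 + (n : ℝ) ^ 2) / (2 * R ^ 2) < κ) :
    ∃ C₁ > (0 : ℝ), ∀ u : ℝ → ℝ, MemX R u → (∃ r ∈ Icc (0 : ℝ) R, u r ≠ 0) →
      gammaK α n κ R u = 0 →
      C₁ ≤ ∫ r in Ioo (0 : ℝ) R, (r * (deriv u r) ^ 2 + (u r) ^ 2 / r) := by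
  have hn2 : (1 : ℝ) ≤ (n : ℝ) ^ 2 := by
    have : 1 ≤ n ^ 2 := by rw [← sq_abs]; nlinarith
    exact_mod_cast this
  set S := besselR0 ^ 2 + (n : ℝ) ^ 2 with hS
  have hSpos : 0 < S := by have := sq_nonneg besselR0; linarith
  obtain ⟨δ, hδ0, hδ1, hδ⟩ : ∃ δ : ℝ, 0 < δ ∧ δ ≤ 1 ∧ -(2 * κ * R ^ 2) ≤ (1 - δ) * S := by
    rw [div_lt_iff₀ (by positivity)] at hκ
    refine ⟨min 1 (1 + 2 * κ * R ^ 2 / S), lt_min one_pos ?_, min_le_left _ _, ?_⟩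
    · have : 0 < (S + 2 * κ * R ^ 2) / S := div_pos (by linarith) hSpos
      rwa [add_div, div_self hSpos.ne'] at this
    · have h1 := min_le_right 1 (1 + 2 * κ * R ^ 2 / S)
      have h2 : (2 * κ * R ^ 2 / S) * S = 2 * κ * R ^ 2 := by field_simp
      nlinarith
  refine ⟨δ / (2 * R ^ 2), by positivity, fun u hu hne hγ => ?_⟩
  have hf := xfacts R u hu
  have hP := poincare R hR u hu
  have hsup := sup_bound R u hu
  set E := ∫ r in Ioo (0 : ℝ) R, (r * (deriv u r) ^ 2 + (u r) ^ 2 / r) with hE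
  have hEAB := integral_add hf.iA hf.iB
  rw [← hE] at hEAB
  have hEpos : 0 < E := by
    obtain ⟨x, hx, hux⟩ := hne
    exact lt_of_lt_of_le (by positivity) (hsup x hx)
  have hBD : ∫ r in Ioo (0 : ℝ) R, r * (u r) ^ 2 ≤ R ^ 2 * ∫ r in Ioo (0 : ℝ) R, (u r) ^ 2 / r := by
    rw [← integral_const_mul]
    refine setIntegral_mono_on hf.iD (hf.iB.const_mul _) measurableSet_Ioo fun r hr => ?_
    have h0 := hr.1
    have : r ^ 2 ≤ R ^ 2 := by gcongr; exact hr.2.le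
    calc r * u r ^ 2 = r ^ 2 * (u r ^ 2 / r) := by field_simp
      _ ≤ _ := by gcongr
  have hA0 : 0 ≤ ∫ r in Ioo (0 : ℝ) R, r * (deriv u r) ^ 2 :=
    setIntegral_nonneg measurableSet_Ioo fun r hr => by have := hr.1; positivity
  have hB0 : 0 ≤ ∫ r in Ioo (0 : ℝ) R, (u r) ^ 2 / r :=
    setIntegral_nonneg measurableSet_Ioo fun r hr => by have := hr.1; positivity
  have hD0 : 0 ≤ ∫ r in Ioo (0 : ℝ) R, r * (u r) ^ 2 :=
    setIntegral_nonneg measurableSet_Ioo fun r hr => by have := hr.1; positivity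
  have iN : IntegrableOn (fun r => 2 * α⁻¹ * r * (u r) ^ 2 / (1 + α * (u r) ^ 2)) (Ioo 0 R) := by
    have hc := hu.1
    have : ContinuousOn (fun r => 2 * α⁻¹ * r * (u r) ^ 2 / (1 + α * (u r) ^ 2)) (Icc 0 R) := by
      refine ContinuousOn.div (by fun_prop) (by fun_prop) (fun r _ => ?_)
      positivity
    exact this.integrableOn_Icc.mono_set Ioo_subset_Icc_self
  have iB' : IntegrableOn (fun r => (n : ℝ) ^ 2 / r * (u r) ^ 2) (Ioo 0 R) :=
    (hf.iB.const_mul ((n : ℝ) ^ 2)).congr (ae_of_all _ fun r => by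
      show (n : ℝ) ^ 2 * (u r ^ 2 / r) = (n : ℝ) ^ 2 / r * (u r) ^ 2
      ring)
  have iD' : IntegrableOn (fun r => 2 * (α⁻¹ - κ) * r * (u r) ^ 2) (Ioo 0 R) :=
    (hf.iD.const_mul (2 * (α⁻¹ - κ))).congr (ae_of_all _ fun r => by
      show 2 * (α⁻¹ - κ) * (r * (u r) ^ 2) = 2 * (α⁻¹ - κ) * r * (u r) ^ 2
      ring)
  have hmain : ∫ r in Ioo (0 : ℝ) R, (r * (deriv u r) ^ 2 + (n : ℝ) ^ 2 * ((u r) ^ 2 / r)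
      + (2 * κ - 2 * E) * (r * (u r) ^ 2)) ≤ 0 := by
    have h0 : ∫ r in Ioo (0 : ℝ) R,
        (r * (deriv u r) ^ 2 + ((n : ℝ) ^ 2 / r) * (u r) ^ 2
      - 2 * (α⁻¹ - κ) * r * (u r) ^ 2 + 2 * α⁻¹ * r * (u r) ^ 2 / (1 + α * (u r) ^ 2)) = 0 := by
      unfold gammaK at hγ
      linarith
    refine le_trans ?_ h0.le
    refine setIntegral_mono_on ((hf.iA.add (hf.iB.const_mul _)).add (hf.iD.const_mul _))
      (((hf.iA.add iB').sub iD').add iN) measurableSet_Ioo fun r hr => ?_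
    show r * (deriv u r) ^ 2 + (n : ℝ) ^ 2 * ((u r) ^ 2 / r)
      + (2 * κ - 2 * E) * (r * (u r) ^ 2) ≤ r * (deriv u r) ^ 2 + ((n : ℝ) ^ 2 / r) * (u r) ^ 2
      - 2 * (α⁻¹ - κ) * r * (u r) ^ 2 + 2 * α⁻¹ * r * (u r) ^ 2 / (1 + α * (u r) ^ 2)
    have hr0 := hr.1
    have hs := hsup r (Ioo_subset_Icc_self hr)
    have hden : 0 < 1 + α * u r ^ 2 := by positivity
    have e : 2 * α⁻¹ * r * (u r) ^ 2 / (1 + α * (u r) ^ 2) =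
        2 * α⁻¹ * r * (u r) ^ 2 - 2 * r * (u r ^ 2 * (u r) ^ 2 / (1 + α * (u r) ^ 2)) := by
      field_simp; ring
    have e2 : u r ^ 2 * (u r) ^ 2 / (1 + α * (u r) ^ 2) ≤ E * u r ^ 2 := by
      rw [div_le_iff₀ hden]
      have h1 : u r ^ 2 * u r ^ 2 ≤ E * u r ^ 2 := by gcongr
      have h2 : 0 ≤ E * u r ^ 2 * (α * u r ^ 2) := by positivity
      nlinarith
    have e3 := mul_le_mul_of_nonneg_left e2 (by positivity : 0 ≤ 2 * r)
    have e4 : (n : ℝ) ^ 2 * ((u r) ^ 2 / r) = (n : ℝ) ^ 2 / r * (u r) ^ 2 := by ring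
    rw [e, e4]
    nlinarith
  have iAB : IntegrableOn (fun r => r * (deriv u r) ^ 2 + (n : ℝ) ^ 2 * ((u r) ^ 2 / r))
      (Ioo 0 R) := hf.iA.add (hf.iB.const_mul _)
  rw [integral_add iAB (hf.iD.const_mul _),
    integral_add hf.iA (hf.iB.const_mul _), integral_const_mul, integral_const_mul] at hmain
  set A := ∫ r in Ioo (0 : ℝ) R, r * (deriv u r) ^ 2
  set B := ∫ r in Ioo (0 : ℝ) R, (u r) ^ 2 / r
  set D := ∫ r in Ioo (0 : ℝ) R, r * (u r) ^ 2
  -- S * D ≤ R² (A + n² B)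
  have hSD : S * D ≤ R ^ 2 * (A + (n : ℝ) ^ 2 * B) := by
    have := mul_le_mul_of_nonneg_left hBD (by positivity : 0 ≤ (n : ℝ) ^ 2)
    rw [hS]; nlinarith
  have h1 : -(2 * κ * R ^ 2) * D ≤ (1 - δ) * (R ^ 2 * (A + (n : ℝ) ^ 2 * B)) := by
    calc _ ≤ (1 - δ) * S * D := by gcongr
      _ = (1 - δ) * (S * D) := by ring
      _ ≤ _ := by gcongr
  have hR2 : 0 < R ^ 2 := by positivity
  have h2 : δ * (A + (n : ℝ) ^ 2 * B) ≤ 2 * E * D := by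
    have := mul_le_mul_of_nonneg_left hmain hR2.le
    refine le_of_mul_le_mul_left ?_ hR2
    nlinarith
  have h3 : δ * E ≤ δ * (A + (n : ℝ) ^ 2 * B) := by
    rw [hEAB]; gcongr; nlinarith
  have h4 : D ≤ R ^ 2 * E := hBD.trans (by gcongr; linarith)
  have h5 : δ * E ≤ (2 * R ^ 2 * E) * E := by
    have := mul_le_mul_of_nonneg_left h4 (by positivity : 0 ≤ 2 * E)
    nlinarith
  rw [div_le_iff₀ (by positivity)]
  have := le_of_mul_le_mul_right h5 hEpos
  linarith
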